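/- Let d ≥ 1 and let M_d be the uncentered maximal operator on (ℝ^d, ‖·‖_∞) associated to ℓ∞ balls, acting on Lipschitz functions with respect to the ℓ∞ norm. Then (d−1)/(d+1) < ‖M_d‖_{Op(1)} ≤ d/(d+1) − (1/(d+1)) (1 − 1/√d) [ 1 − (1 − 1/(2√d − 1))^d ]. In particular ‖M_d‖_{Op(1)} = (d−1)/(d+1) + o(1/(d+1)) as d → ∞. -/

import Mathlib

open MeasureTheory Set Filter Topology

/-- The closed ball of the norm-like function `N`, with center `c` and radius `R`. -/
def nball {d : ℕ} (N : (Fin d → ℝ) → ℝ) (c : Fin d → ℝ) (R : ℝ) : Set (Fin d → ℝ) :=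
  {y | N (y - c) ≤ R}

/-- The uncentered Hardy–Littlewood maximal function associated to the norm `N`,
with respect to `d`-dimensional Lebesgue measure. -/
noncomputable def maxFn {d : ℕ} (N : (Fin d → ℝ) → ℝ) (f : (Fin d → ℝ) → ℝ)
    (x : Fin d → ℝ) : ℝ :=
  sSup {a : ℝ | ∃ c : Fin d → ℝ, ∃ R : ℝ, 0 < R ∧ x ∈ nball N c R ∧
    a = ⨍ y in nball N c R, |f y|}

/-- The modulus of continuity of `g`, with distances measured using `N`. -/
noncomputable def modCont {d : ℕ} (N : (Fin d → ℝ) → ℝ) (g : (Fin d → ℝ) → ℝ) (δ : ℝ) : ℝ :=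
  sSup {a : ℝ | ∃ x y : Fin d → ℝ, N (x - y) ≤ δ ∧ a = |g x - g y|}

/-- `N` is a norm on `ℝ^d`. -/
structure IsNorm {d : ℕ} (N : (Fin d → ℝ) → ℝ) : Prop where
  eq_zero_iff : ∀ x, N x = 0 ↔ x = 0
  add_le : ∀ x y, N (x + y) ≤ N x + N y
  smul : ∀ (a : ℝ) (x), N (a • x) = |a| * N x

/-- `ω` is a modulus of continuity: continuous, nondecreasing, subadditive on `[0,∞)`,
vanishing at `0`, nonnegative, and not identically zero. -/
structure IsModulus (ω : ℝ → ℝ) : Prop where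
  nonneg : ∀ t, 0 ≤ t → 0 ≤ ω t
  map_zero : ω 0 = 0
  mono : MonotoneOn ω (Ici 0)
  subadd : ∀ a b, 0 ≤ a → 0 ≤ b → ω (a + b) ≤ ω a + ω b
  cont : ContinuousOn ω (Ici 0)
  nontrivial : ∃ t, 0 < t ∧ ω t ≠ 0

/-- The `Lip(ω)` seminorm of `f`: `sup_{t>0} ω(f,t)/ω(t)`. -/
noncomputable def lipNorm {d : ℕ} (N : (Fin d → ℝ) → ℝ) (ω : ℝ → ℝ)
    (f : (Fin d → ℝ) → ℝ) : ℝ :=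
  sSup {a : ℝ | ∃ t : ℝ, 0 < t ∧ a = modCont N f t / ω t}

/-- The operator norm of the uncentered maximal operator on `Lip(ω)`. -/
noncomputable def opNorm (d : ℕ) (N : (Fin d → ℝ) → ℝ) (ω : ℝ → ℝ) : ℝ :=
  sSup {a : ℝ | ∃ f : (Fin d → ℝ) → ℝ, lipNorm N ω f = 1 ∧ a = lipNorm N ω (maxFn N f)}

/-- The Hölder `α` seminorm of `f`, distances measured with `N`. -/
noncomputable def holderNorm {d : ℕ} (N : (Fin d → ℝ) → ℝ) (α : ℝ)
    (f : (Fin d → ℝ) → ℝ) : ℝ :=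
  sSup {a : ℝ | ∃ x y : Fin d → ℝ, x ≠ y ∧ a = |f x - f y| / N (x - y) ^ α}

/-- The operator norm of the uncentered maximal operator on the Hölder class `Lip_α`. -/
noncomputable def opNormHolder (d : ℕ) (N : (Fin d → ℝ) → ℝ) (α : ℝ) : ℝ :=
  sSup {a : ℝ | ∃ f : (Fin d → ℝ) → ℝ, holderNorm N α f = 1 ∧
    a = holderNorm N α (maxFn N f)}

theorem volume_real_inter_ball {d : ℕ} {s u : ℝ} (hs0 : 0 ≤ s)
    (hu0 : 0 ≤ u) (hu1 : u ≤ 1) (ε : Fin d → ℝ) (hε : ∀ i, ε i = 1 ∨ ε i = -1) :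
    volume.real ({v : Fin d → ℝ | ‖((1 - s) / 2) • ε + ((1 + s) / 2) • v‖ ≤ u} ∩
      Metric.closedBall 0 1) = ((min u s + u) / ((1 + s) / 2)) ^ d := by
  have hq : 0 < (1 + s) / 2 := by linarith
  have hm0 : 0 ≤ min u s := le_min hu0 hs0
  have key : ({v : Fin d → ℝ | ‖((1 - s) / 2) • ε + ((1 + s) / 2) • v‖ ≤ u} ∩
      Metric.closedBall 0 1) =
      Set.Icc (fun i => if ε i = 1 then (-(min u s) - (1 - s) / 2) / ((1 + s) / 2)
          else (-u + (1 - s) / 2) / ((1 + s) / 2))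
        (fun i => if ε i = 1 then (u - (1 - s) / 2) / ((1 + s) / 2)
          else (min u s + (1 - s) / 2) / ((1 + s) / 2)) := by
    ext v
    simp only [mem_inter_iff, mem_ofPred_eq, mem_closedBall_zero_iff, pi_norm_le_iff_of_nonneg hu0,
      pi_norm_le_iff_of_nonneg zero_le_one, Set.mem_Icc, Pi.le_def, ← forall_and]
    refine forall_congr' fun i => ?_
    simp only [Pi.add_apply, Pi.smul_apply, smul_eq_mul, Real.norm_eq_abs, abs_le]
    rcases hε i with h | h
    · rw [h, if_pos rfl, if_pos rfl, div_le_iff₀ hq, le_div_iff₀ hq]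
      constructor
      · rintro ⟨⟨h1, h2⟩, h3, h4⟩
        refine ⟨?_, by linarith⟩
        rcases min_choice u s with h | h <;> rw [h] <;> nlinarith
      · rintro ⟨h1, h2⟩
        have := min_le_left u s
        have := min_le_right u s
        refine ⟨⟨by linarith, by linarith⟩, ?_, ?_⟩
        · by_contra! hc
          nlinarith
        · by_contra! hc
          nlinarith
    · rw [h, if_neg (by norm_num), if_neg (by norm_num), div_le_iff₀ hq, le_div_iff₀ hq]
      constructor
      · rintro ⟨⟨h1, h2⟩, h3, h4⟩
        refine ⟨by linarith, ?_⟩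
        rcases min_choice u s with h | h <;> rw [h] <;> nlinarith
      · rintro ⟨h1, h2⟩
        have := min_le_left u s
        have := min_le_right u s
        refine ⟨⟨by linarith, by linarith⟩, ?_, ?_⟩
        · by_contra! hc
          nlinarith
        · by_contra! hc
          nlinarith
  rw [key, Measure.real, Real.volume_Icc_pi, Finset.prod_congr rfl
    (g := fun _ => ENNReal.ofReal ((min u s + u) / ((1 + s) / 2)))]
  · rw [Finset.prod_const, Finset.card_univ, Fintype.card_fin, ENNReal.toReal_pow,
      ENNReal.toReal_ofReal (by positivity)]
  · intro i _
    congr 1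
    split_ifs <;> ring

theorem integral_min_add_pow {d : ℕ} {s : ℝ} (hs0 : 0 ≤ s) (hs1 : s ≤ 1) :
    ∫ u in (0 : ℝ)..1, ((min u s + u) / ((1 + s) / 2)) ^ d =
      2 ^ d * ((1 + s - s * (2 * s / (1 + s)) ^ d) / (d + 1)) := by
  have hc : Continuous fun u : ℝ => ((min u s + u) / ((1 + s) / 2)) ^ d := by fun_prop
  rw [← intervalIntegral.integral_add_adjacent_intervals (hc.intervalIntegrable 0 s)
    (hc.intervalIntegrable s 1)]
  have h1 : ∫ u in (0 : ℝ)..s, ((min u s + u) / ((1 + s) / 2)) ^ d =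
      ∫ u in (0 : ℝ)..s, (4 / (1 + s)) ^ d * u ^ d := by
    refine intervalIntegral.integral_congr fun u hu => ?_
    rw [uIcc_of_le hs0] at hu
    simp only [min_eq_left hu.2, ← mul_pow]
    congr 1
    field_simp
    ring
  have h2 : ∫ u in s..(1 : ℝ), ((min u s + u) / ((1 + s) / 2)) ^ d =
      ∫ u in s..(1 : ℝ), (2 / (1 + s)) ^ d * (u + s) ^ d := by
    refine intervalIntegral.integral_congr fun u hu => ?_
    rw [uIcc_of_le hs1] at hu
    simp only [min_eq_right hu.1, ← mul_pow]
    congr 1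
    field_simp
    ring
  have hp : (0 : ℝ) < 1 + s := by linarith
  rw [h1, h2, intervalIntegral.integral_const_mul, intervalIntegral.integral_const_mul,
    intervalIntegral.integral_comp_add_right (fun x => x ^ d), integral_pow, integral_pow,
    div_pow, div_pow, div_pow, show (4 : ℝ) = 2 * 2 by norm_num, mul_pow, mul_pow,
    show s + s = 2 * s by ring, mul_pow]
  field_simp
  ring

theorem integral_one_sub_norm {d : ℕ} {s : ℝ} (hs0 : 0 ≤ s) (hs1 : s ≤ 1)
    (ε : Fin d → ℝ) (hε : ∀ i, ε i = 1 ∨ ε i = -1) :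
    ∫ v in Metric.closedBall (0 : Fin d → ℝ) 1,
      (1 - ‖((1 - s) / 2) • ε + ((1 + s) / 2) • v‖) =
      2 ^ d * ((1 + s - s * (2 * s / (1 + s)) ^ d) / (d + 1)) := by
  have hcont : Continuous fun v : Fin d → ℝ => 1 - ‖((1 - s) / 2) • ε + ((1 + s) / 2) • v‖ := by
    fun_prop
  have hnn : ∀ v ∈ Metric.closedBall (0 : Fin d → ℝ) 1,
      0 ≤ 1 - ‖((1 - s) / 2) • ε + ((1 + s) / 2) • v‖ := by
    intro v hv
    rw [mem_closedBall_zero_iff] at hv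
    have h1 : ‖ε‖ ≤ 1 := by
      rw [pi_norm_le_iff_of_nonneg zero_le_one]
      intro i
      rcases hε i with h | h <;> simp [h]
    have h2 := norm_add_le (((1 - s) / 2) • ε) (((1 + s) / 2) • v)
    rw [norm_smul, norm_smul, Real.norm_of_nonneg (by linarith : 0 ≤ (1 - s) / 2),
      Real.norm_of_nonneg (by linarith : 0 ≤ (1 + s) / 2)] at h2
    nlinarith
  rw [Integrable.integral_eq_integral_Ioc_meas_le (M := 1)
    (hcont.continuousOn.integrableOn_compact (isCompact_closedBall _ _))
    ((ae_restrict_iff' measurableSet_closedBall).2 (ae_of_all _ hnn))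
    (ae_of_all _ fun v => by simp)]
  rw [← intervalIntegral.integral_of_le zero_le_one, ← integral_min_add_pow hs0 hs1]
  have := intervalIntegral.integral_comp_sub_left
    (fun u : ℝ => ((min u s + u) / ((1 + s) / 2)) ^ d) (a := 0) (b := 1) 1
  rw [sub_zero, sub_self] at this
  rw [← this]
  refine intervalIntegral.integral_congr fun t ht => ?_
  rw [uIcc_of_le zero_le_one] at ht
  rw [← volume_real_inter_ball hs0 (by linarith [ht.2]) (by linarith [ht.1]) ε hε,
    measureReal_restrict_apply (measurableSet_le measurable_const hcont.measurable)]
  congr 2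
  ext v
  simp only [mem_ofPred_eq]
  constructor <;> intro h <;> linarith

theorem nball_norm_eq {d : ℕ} (c : Fin d → ℝ) (R : ℝ) :
    nball (fun x => ‖x‖) c R = Metric.closedBall c R := by
  ext y
  simp [nball, dist_eq_norm]

theorem volume_real_unitBall (d : ℕ) :
    volume.real (Metric.closedBall (0 : Fin d → ℝ) 1) = 2 ^ d := by
  rw [Measure.real, Real.volume_pi_closedBall _ zero_le_one]
  simp

theorem setIntegral_closedBall_eq {d : ℕ} (F : (Fin d → ℝ) → ℝ) (c : Fin d → ℝ) {R : ℝ}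
    (hR : 0 < R) :
    ∫ y in Metric.closedBall c R, F y =
      R ^ d * ∫ v in Metric.closedBall (0 : Fin d → ℝ) 1, F (c + R • v) := by
  rw [Measure.setIntegral_comp_smul_of_pos volume (fun w => F (c + w)) _ hR,
    smul_unitClosedBall_of_nonneg hR.le, Module.finrank_fin_fun, smul_eq_mul,
    mul_inv_cancel_left₀ (by positivity)]
  have h := (measurePreserving_add_left (volume : Measure (Fin d → ℝ)) c).setIntegral_preimage_emb
    (measurableEmbedding_addLeft c) F (Metric.closedBall c R)
  rw [← h]
  congr 2
  ext y
  simp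

theorem average_nball {d : ℕ} (F : (Fin d → ℝ) → ℝ) (c : Fin d → ℝ) {R : ℝ} (hR : 0 < R) :
    ⨍ y in nball (fun x => ‖x‖) c R, F y =
      (2 ^ d)⁻¹ * ∫ v in Metric.closedBall (0 : Fin d → ℝ) 1, F (c + R • v) := by
  rw [nball_norm_eq, setAverage_eq, setIntegral_closedBall_eq F c hR, Measure.real,
    Real.volume_pi_closedBall _ hR.le, ENNReal.toReal_ofReal (by positivity), Fintype.card_fin,
    smul_eq_mul, mul_pow]
  field_simp

/-- The average of `‖·‖` over the cube `[-s, 1]^d`. -/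
noncomputable def cubeNormAvg (d : ℕ) (s : ℝ) : ℝ :=
  1 - (1 + s - s * (2 * s / (1 + s)) ^ d) / (d + 1)

theorem integral_norm_cube {d : ℕ} {s : ℝ} (hs0 : 0 ≤ s) (hs1 : s ≤ 1)
    (ε : Fin d → ℝ) (hε : ∀ i, ε i = 1 ∨ ε i = -1) :
    ∫ v in Metric.closedBall (0 : Fin d → ℝ) 1, ‖((1 - s) / 2) • ε + ((1 + s) / 2) • v‖ =
      2 ^ d * cubeNormAvg d s := by
  have h := integral_one_sub_norm hs0 hs1 ε hε
  rw [integral_sub] at h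
  · rw [setIntegral_const, volume_real_unitBall, smul_eq_mul] at h
    rw [cubeNormAvg, mul_sub, ← h]
    ring
  · exact continuous_const.continuousOn.integrableOn_compact (isCompact_closedBall _ _)
  · exact Continuous.continuousOn (by fun_prop) |>.integrableOn_compact (isCompact_closedBall _ _)

theorem cubeNormAvg_nonneg {d : ℕ} {s : ℝ} (hs0 : 0 ≤ s) (hs1 : s ≤ 1) : 0 ≤ cubeNormAvg d s := by
  have h := integral_norm_cube (d := d) hs0 hs1 (fun _ => 1) (fun _ => Or.inl rfl)
  have : 0 ≤ 2 ^ d * cubeNormAvg d s := h ▸ integral_nonneg fun _ => norm_nonneg _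
  exact nonneg_of_mul_nonneg_right this (by positivity)

/-- Moving the point by `y - x`, a ball around `x` can be replaced by a homothetic ball around `y`
on which the average of a `1`-Lipschitz function drops by at most `cubeNormAvg d s * ‖x - y‖`. -/
theorem exists_nball_average_le {d : ℕ} {s : ℝ} (hs0 : 0 ≤ s) (hs1 : s ≤ 1)
    {f : (Fin d → ℝ) → ℝ} (hf : ∀ x y, |f x - f y| ≤ ‖x - y‖) (x y c : Fin d → ℝ) {R : ℝ}
    (hR : 0 < R) (hx : x ∈ nball (fun x => ‖x‖) c R) :
    ∃ c' : Fin d → ℝ, ∃ R' : ℝ, 0 < R' ∧ y ∈ nball (fun x => ‖x‖) c' R' ∧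
      ⨍ z in nball (fun x => ‖x‖) c R, |f z| ≤
        (⨍ z in nball (fun x => ‖x‖) c' R', |f z|) + cubeNormAvg d s * ‖x - y‖ := by
  set δ := ‖x - y‖ with hδ
  have hδ0 : 0 ≤ δ := norm_nonneg _
  set ε : Fin d → ℝ := fun i => if 0 ≤ y i - c i then 1 else -1 with hεdef
  have hε : ∀ i, ε i = 1 ∨ ε i = -1 := fun i => by
    simp only [hεdef]; split_ifs <;> simp
  have hR' : 0 < R + δ * ((1 + s) / 2) := by positivity
  refine ⟨c + δ • ((1 - s) / 2) • ε, R + δ * ((1 + s) / 2), hR', ?_, ?_⟩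
  · have hx' : ‖x - c‖ ≤ R := hx
    change ‖y - (c + δ • ((1 - s) / 2) • ε)‖ ≤ R + δ * ((1 + s) / 2)
    rw [pi_norm_le_iff_of_nonneg hR'.le]
    intro i
    have h1 := (norm_le_pi_norm (x - c) i).trans hx'
    have h2 := norm_le_pi_norm (x - y) i
    rw [← hδ] at h2
    simp only [Pi.sub_apply, Pi.add_apply, Pi.smul_apply, smul_eq_mul, Real.norm_eq_abs,
      abs_le] at h1 h2 ⊢
    simp only [hεdef]
    have h3 : 0 ≤ δ * s := by positivity
    split_ifs with h <;> constructor <;> linarith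
  · have hfc : Continuous f := by
      refine (LipschitzWith.of_dist_le_mul (K := 1) fun a b => ?_).continuous
      rw [Real.dist_eq, dist_eq_norm, NNReal.coe_one, one_mul]
      exact hf a b
    have hint : ∀ g : (Fin d → ℝ) → ℝ, Continuous g →
        IntegrableOn g (Metric.closedBall (0 : Fin d → ℝ) 1) := fun g hg =>
      hg.continuousOn.integrableOn_compact (isCompact_closedBall _ _)
    rw [average_nball _ _ hR, average_nball _ _ hR']
    have h := integral_norm_cube hs0 hs1 ε hε
    have hJ : cubeNormAvg d s * δ = (2 ^ d)⁻¹ *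
        ∫ v in Metric.closedBall (0 : Fin d → ℝ) 1,
          ‖((1 - s) / 2) • ε + ((1 + s) / 2) • v‖ * δ := by
      rw [integral_mul_const, h]
      field_simp
    rw [hJ, ← mul_add, ← integral_add (hint _ (by fun_prop)) (hint _ (by fun_prop))]
    refine mul_le_mul_of_nonneg_left ?_ (by positivity)
    refine integral_mono (hint _ (by fun_prop)) (hint _ (by fun_prop)) fun v => ?_
    have h1 := abs_sub_abs_le_abs_sub (f (c + R • v))
      (f (c + δ • ((1 - s) / 2) • ε + (R + δ * ((1 + s) / 2)) • v))
    have h2 := hf (c + R • v) (c + δ • ((1 - s) / 2) • ε + (R + δ * ((1 + s) / 2)) • v)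
    have h3 : c + R • v - (c + δ • ((1 - s) / 2) • ε + (R + δ * ((1 + s) / 2)) • v) =
        -(δ • (((1 - s) / 2) • ε + ((1 + s) / 2) • v)) := by
      rw [add_smul, smul_add, mul_smul]
      abel
    rw [h3, norm_neg, norm_smul, Real.norm_of_nonneg hδ0] at h2
    simp only
    linarith

theorem maxFn_sub_le {d : ℕ} {s : ℝ} (hs0 : 0 ≤ s) (hs1 : s ≤ 1)
    {f : (Fin d → ℝ) → ℝ} (hf : ∀ x y, |f x - f y| ≤ ‖x - y‖) (x y : Fin d → ℝ) :
    |maxFn (fun x => ‖x‖) f x - maxFn (fun x => ‖x‖) f y| ≤ cubeNormAvg d s * ‖x - y‖ := by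
  set S : (Fin d → ℝ) → Set ℝ := fun x => {a : ℝ | ∃ c : Fin d → ℝ, ∃ R : ℝ, 0 < R ∧
    x ∈ nball (fun x => ‖x‖) c R ∧ a = ⨍ y in nball (fun x => ‖x‖) c R, |f y|} with hS
  have hne : ∀ x, (S x).Nonempty := fun x =>
    ⟨_, x, 1, one_pos, by simp [nball], rfl⟩
  have hstep : ∀ x y, ∀ a ∈ S x, ∃ b ∈ S y, a ≤ b + cubeNormAvg d s * ‖x - y‖ := by
    rintro x y a ⟨c, R, hR, hx, rfl⟩
    obtain ⟨c', R', hR', hy, h⟩ := exists_nball_average_le hs0 hs1 hf x y c hR hx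
    exact ⟨_, ⟨c', R', hR', hy, rfl⟩, h⟩
  have hbdd : ∀ x y, BddAbove (S y) → BddAbove (S x) := by
    rintro x y ⟨B, hB⟩
    refine ⟨B + cubeNormAvg d s * ‖x - y‖, fun a ha => ?_⟩
    obtain ⟨b, hb, hab⟩ := hstep x y a ha
    linarith [hB hb]
  have hle : ∀ x y, BddAbove (S y) → sSup (S x) ≤ sSup (S y) + cubeNormAvg d s * ‖x - y‖ := by
    intro x y hy
    refine csSup_le (hne x) fun a ha => ?_
    obtain ⟨b, hb, hab⟩ := hstep x y a ha
    linarith [le_csSup hy hb]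
  change |sSup (S x) - sSup (S y)| ≤ _
  by_cases hy : BddAbove (S y)
  · have h1 := hle x y hy
    have h2 := hle y x (hbdd x y hy)
    rw [norm_sub_rev] at h2
    rw [abs_le]
    constructor <;> linarith
  · rw [Real.sSup_of_not_bddAbove hy, Real.sSup_of_not_bddAbove fun hx => hy (hbdd y x hx)]
    simpa using mul_nonneg (cubeNormAvg_nonneg hs0 hs1) (norm_nonneg _)

theorem le_holderNorm_one {d : ℕ} {f : (Fin d → ℝ) → ℝ} {K : ℝ}
    (hf : ∀ x y, |f x - f y| ≤ K * ‖x - y‖) {x y : Fin d → ℝ} (hxy : x ≠ y) :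
    |f x - f y| / ‖x - y‖ ≤ holderNorm (fun x => ‖x‖) 1 f := by
  refine le_csSup ⟨K, ?_⟩ ⟨x, y, hxy, by rw [Real.rpow_one]⟩
  rintro _ ⟨x, y, hxy, rfl⟩
  rw [Real.rpow_one, div_le_iff₀ (norm_pos_iff.2 (sub_ne_zero.2 hxy))]
  exact hf x y

theorem holderNorm_one_le {d : ℕ} {f : (Fin d → ℝ) → ℝ} {K : ℝ} (hK : 0 ≤ K)
    (hf : ∀ x y, |f x - f y| ≤ K * ‖x - y‖) : holderNorm (fun x => ‖x‖) 1 f ≤ K := by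
  refine Real.sSup_le ?_ hK
  rintro _ ⟨x, y, hxy, rfl⟩
  rw [Real.rpow_one, div_le_iff₀ (norm_pos_iff.2 (sub_ne_zero.2 hxy))]
  exact hf x y

theorem abs_sub_le_of_holderNorm_one_eq {d : ℕ} {f : (Fin d → ℝ) → ℝ}
    (hf : holderNorm (fun x => ‖x‖) 1 f = 1) (x y : Fin d → ℝ) : |f x - f y| ≤ ‖x - y‖ := by
  rcases eq_or_ne x y with rfl | hxy
  · simp
  have hb : BddAbove {a : ℝ | ∃ x y : Fin d → ℝ, x ≠ y ∧ a = |f x - f y| / ‖x - y‖ ^ (1 : ℝ)} := by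
    by_contra h
    rw [holderNorm, Real.sSup_of_not_bddAbove h] at hf
    exact zero_ne_one hf
  have h := le_csSup hb ⟨x, y, hxy, rfl⟩
  rw [Real.rpow_one, div_le_iff₀ (norm_pos_iff.2 (sub_ne_zero.2 hxy))] at h
  change _ ≤ holderNorm (fun x => ‖x‖) 1 f * _ at h
  rwa [hf, one_mul] at h

theorem holderNorm_maxFn_le {d : ℕ} {s : ℝ} (hs0 : 0 ≤ s) (hs1 : s ≤ 1)
    {f : (Fin d → ℝ) → ℝ} (hf : holderNorm (fun x => ‖x‖) 1 f = 1) :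
    holderNorm (fun x => ‖x‖) 1 (maxFn (fun x => ‖x‖) f) ≤ cubeNormAvg d s :=
  holderNorm_one_le (cubeNormAvg_nonneg hs0 hs1)
    (maxFn_sub_le hs0 hs1 (abs_sub_le_of_holderNorm_one_eq hf))

theorem opNormHolder_one_le {d : ℕ} {s : ℝ} (hs0 : 0 ≤ s) (hs1 : s ≤ 1) :
    opNormHolder d (fun x => ‖x‖) 1 ≤ cubeNormAvg d s := by
  refine Real.sSup_le ?_ (cubeNormAvg_nonneg hs0 hs1)
  rintro _ ⟨f, hf, rfl⟩
  exact holderNorm_maxFn_le hs0 hs1 hf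

theorem holderNorm_maxFn_le_opNormHolder {d : ℕ} {f : (Fin d → ℝ) → ℝ}
    (hf : holderNorm (fun x => ‖x‖) 1 f = 1) :
    holderNorm (fun x => ‖x‖) 1 (maxFn (fun x => ‖x‖) f) ≤ opNormHolder d (fun x => ‖x‖) 1 := by
  refine le_csSup ⟨cubeNormAvg d 0, ?_⟩ ⟨f, hf, rfl⟩
  rintro _ ⟨g, hg, rfl⟩
  exact holderNorm_maxFn_le le_rfl zero_le_one hg

theorem abs_cone_sub_le {d : ℕ} (x y : Fin d → ℝ) :
    |max 0 (1 - ‖x‖) - max 0 (1 - ‖y‖)| ≤ ‖x - y‖ := by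
  refine (abs_max_sub_max_le_max 0 (1 - ‖x‖) 0 (1 - ‖y‖)).trans ?_
  rw [sub_self, abs_zero, max_eq_right (abs_nonneg _), sub_sub_sub_cancel_left, norm_sub_rev]
  exact abs_norm_sub_norm_le y x

theorem holderNorm_cone {d : ℕ} (hd : 1 ≤ d) :
    holderNorm (fun x : Fin d → ℝ => ‖x‖) 1 (fun z => max 0 (1 - ‖z‖)) = 1 := by
  have : Nonempty (Fin d) := ⟨⟨0, hd⟩⟩
  have h : ∀ x y : Fin d → ℝ, |max 0 (1 - ‖x‖) - max 0 (1 - ‖y‖)| ≤ 1 * ‖x - y‖ := fun x y => by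
    rw [one_mul]; exact abs_cone_sub_le x y
  refine le_antisymm (holderNorm_one_le zero_le_one h) ?_
  have := le_holderNorm_one h (x := 0) (y := 1) zero_ne_one
  simpa using this

theorem one_le_maxFn_cone_zero (d : ℕ) :
    1 ≤ maxFn (fun x : Fin d → ℝ => ‖x‖) (fun z => max 0 (1 - ‖z‖)) 0 := by
  have hint : ∀ (R : ℝ), IntegrableOn (fun v : Fin d → ℝ => |max 0 (1 - ‖(0 : Fin d → ℝ) + R • v‖)|)
      (Metric.closedBall (0 : Fin d → ℝ) 1) := fun R =>
    Continuous.continuousOn (by fun_prop) |>.integrableOn_compact (isCompact_closedBall _ _)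
  have hc : ∀ a : ℝ, IntegrableOn (fun _ : Fin d → ℝ => a)
      (Metric.closedBall (0 : Fin d → ℝ) 1) := fun a =>
    continuous_const.continuousOn.integrableOn_compact (isCompact_closedBall _ _)
  have hconst : ∀ a : ℝ, (2 ^ d)⁻¹ * ∫ _ in Metric.closedBall (0 : Fin d → ℝ) 1, a = a := by
    intro a
    rw [setIntegral_const, volume_real_unitBall, smul_eq_mul]
    field_simp
  refine le_of_forall_pos_sub_le fun R hR => ?_
  refine le_trans ?_ (le_csSup ⟨1, ?_⟩ ⟨0, R, hR, by simpa [nball] using hR.le, rfl⟩)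
  · rw [average_nball _ _ hR, ← hconst (1 - R)]
    refine mul_le_mul_of_nonneg_left ?_ (by positivity)
    refine setIntegral_mono_on (hc _) (hint R) measurableSet_closedBall fun v hv => ?_
    rw [mem_closedBall_zero_iff] at hv
    refine le_trans ?_ (le_abs_self _)
    refine le_trans ?_ (le_max_right _ _)
    rw [zero_add, norm_smul, Real.norm_of_nonneg hR.le]
    nlinarith
  · rintro _ ⟨c, R, hR, -, rfl⟩
    rw [average_nball _ _ hR]
    refine le_trans ?_ (hconst 1).le
    refine mul_le_mul_of_nonneg_left ?_ (by positivity)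
    refine setIntegral_mono_on ?_ (hc 1) measurableSet_closedBall fun v hv => ?_
    · exact Continuous.continuousOn (by fun_prop) |>.integrableOn_compact (isCompact_closedBall _ _)
    · rw [abs_of_nonneg (le_max_left _ _)]
      exact max_le zero_le_one (by linarith [norm_nonneg (c + R • v)])

theorem average_cone_le_two_mul {d : ℕ} (hd : 1 ≤ d) {c : Fin d → ℝ} {R : ℝ} (hR : 0 < R)
    (hc : 1 ∈ nball (fun x => ‖x‖) c R) :
    ⨍ z in nball (fun x => ‖x‖) c R, |max 0 (1 - ‖z‖)| ≤ 2 * R / (d + 1) := by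
  have : Nonempty (Fin d) := ⟨⟨0, hd⟩⟩
  have h0 := integral_one_sub_norm (d := d) le_rfl zero_le_one 1 fun _ => Or.inl rfl
  have : 2 * R / (d + 1) = (2 ^ d)⁻¹ * ∫ v in Metric.closedBall (0 : Fin d → ℝ) 1,
      2 * R * (1 - ‖((1 - (0 : ℝ)) / 2) • (1 : Fin d → ℝ) + ((1 + (0 : ℝ)) / 2) • v‖) := by
    rw [integral_const_mul, h0]
    field_simp
    ring
  rw [average_nball _ _ hR, this]
  refine mul_le_mul_of_nonneg_left ?_ (by positivity)
  refine setIntegral_mono_on ?_ ?_ measurableSet_closedBall fun v hv => ?_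
  · exact Continuous.continuousOn (by fun_prop) |>.integrableOn_compact (isCompact_closedBall _ _)
  · exact Continuous.continuousOn (by fun_prop) |>.integrableOn_compact (isCompact_closedBall _ _)
  rw [mem_closedBall_zero_iff, pi_norm_le_iff_of_nonneg zero_le_one] at hv
  change ‖1 - c‖ ≤ R at hc
  rw [pi_norm_le_iff_of_nonneg hR.le] at hc
  obtain ⟨i, -, hi⟩ := Finset.exists_mem_eq_sup' Finset.univ_nonempty
    (fun i => ‖(((1 - (0 : ℝ)) / 2) • (1 : Fin d → ℝ) + ((1 + (0 : ℝ)) / 2) • v) i‖)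
  have hn : ‖((1 - (0 : ℝ)) / 2) • (1 : Fin d → ℝ) + ((1 + (0 : ℝ)) / 2) • v‖ = (1 + v i) / 2 := by
    have hvi := abs_le.1 (hv i)
    refine le_antisymm ?_ ?_
    · rw [pi_norm_le_iff_of_nonneg (by linarith)]
      intro j
      refine (Finset.le_sup' (fun i => ‖(((1 - (0 : ℝ)) / 2) • (1 : Fin d → ℝ) +
        ((1 + (0 : ℝ)) / 2) • v) i‖) (Finset.mem_univ j)).trans (hi.le.trans ?_)
      simp only [Pi.add_apply, Pi.smul_apply, Pi.one_apply, smul_eq_mul, Real.norm_eq_abs]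
      rw [abs_of_nonneg] <;> linarith
    · refine le_trans ?_ (norm_le_pi_norm _ i)
      simp only [Pi.add_apply, Pi.smul_apply, Pi.one_apply, smul_eq_mul, Real.norm_eq_abs]
      refine le_trans ?_ (le_abs_self _)
      linarith
  have hvi := abs_le.1 (hv i)
  have hci := abs_le.1 (hc i)
  have hle := (le_abs_self _).trans (norm_le_pi_norm (c + R • v) i)
  simp only [Pi.add_apply, Pi.smul_apply, Pi.sub_apply, Pi.one_apply, smul_eq_mul] at hle hci
  rw [hn, abs_of_nonneg (le_max_left _ _)]
  refine max_le ?_ ?_ <;> nlinarith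

theorem average_cone_le_inv_pow {d : ℕ} (c : Fin d → ℝ) {R : ℝ} (hR : 0 < R) :
    ⨍ z in nball (fun x => ‖x‖) c R, |max 0 (1 - ‖z‖)| ≤ (R ^ d)⁻¹ / (d + 1) := by
  have hcont : Continuous fun z : Fin d → ℝ => |max 0 (1 - ‖z‖)| := by fun_prop
  have hzero : ∀ z ∉ Metric.closedBall (0 : Fin d → ℝ) 1, |max 0 (1 - ‖z‖)| = 0 := by
    intro z hz
    rw [mem_closedBall_zero_iff, not_le] at hz
    rw [max_eq_left (by linarith), abs_zero]
  have hint : Integrable fun z : Fin d → ℝ => |max 0 (1 - ‖z‖)| :=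
    (integrableOn_iff_integrable_of_support_subset fun z hz => by
      by_contra h; exact hz (hzero z h)).1
      (hcont.continuousOn.integrableOn_compact (isCompact_closedBall _ _))
  have h1 : ∫ z in Metric.closedBall c R, |max 0 (1 - ‖z‖)| ≤ 2 ^ d * (1 / (d + 1)) := by
    refine (setIntegral_le_integral hint (ae_of_all _ fun _ => abs_nonneg _)).trans ?_
    rw [← setIntegral_eq_integral_of_forall_compl_eq_zero hzero]
    have h := integral_one_sub_norm (d := d) zero_le_one le_rfl 1 fun _ => Or.inl rfl
    norm_num at h
    rw [one_div, ← h]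
    refine (setIntegral_congr_fun measurableSet_closedBall fun v hv => ?_).le
    rw [mem_closedBall_zero_iff] at hv
    rw [max_eq_right (by linarith), abs_of_nonneg (by linarith)]
  rw [setIntegral_closedBall_eq _ _ hR] at h1
  rw [average_nball _ _ hR]
  have h2 : (0 : ℝ) < (R ^ d)⁻¹ * (2 ^ d)⁻¹ := by positivity
  have h3 := mul_le_mul_of_nonneg_left h1 h2.le
  field_simp at h3 ⊢
  exact h3

theorem average_cone_le {d : ℕ} (hd : 1 ≤ d) {c : Fin d → ℝ} {R : ℝ} (hR : 0 < R)
    (hc : 1 ∈ nball (fun x => ‖x‖) c R) :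
    ⨍ z in nball (fun x => ‖x‖) c R, |max 0 (1 - ‖z‖)| ≤ (2 - 1 / (2 * d)) / (d + 1) := by
  have hd' : (1 : ℝ) ≤ d := by exact_mod_cast hd
  have hd2 : 1 / (2 * (d : ℝ)) ≤ 1 / 2 := one_div_le_one_div_of_le (by norm_num) (by linarith)
  have hd4 : 1 / (4 * (d : ℝ)) = 1 / (2 * d) / 2 := by field_simp; norm_num
  rcases le_total R (1 - 1 / (4 * d)) with h | h
  · refine (average_cone_le_two_mul hd hR hc).trans ?_
    gcongr
    linarith
  · refine (average_cone_le_inv_pow c hR).trans ?_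
    gcongr
    have hb : 1 + (d : ℝ) * (-(1 / (4 * d))) ≤ (1 + -(1 / (4 * (d : ℝ)))) ^ d :=
      one_add_mul_le_pow (by linarith) d
    have hb' : (d : ℝ) * (-(1 / (4 * d))) = -(1 / 4) := by field_simp
    have hp : (1 + -(1 / (4 * (d : ℝ)))) ^ d ≤ R ^ d :=
      pow_le_pow_left₀ (by linarith) (by linarith) d
    have h34 : (3 / 4 : ℝ) ≤ R ^ d := by linarith
    have := inv_anti₀ (by norm_num) h34
    linarith

theorem lt_opNormHolder_one {d : ℕ} (hd : 1 ≤ d) :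
    ((d : ℝ) - 1) / (d + 1) < opNormHolder d (fun x => ‖x‖) 1 := by
  have : Nonempty (Fin d) := ⟨⟨0, hd⟩⟩
  have hd' : (1 : ℝ) ≤ d := by exact_mod_cast hd
  have hone : maxFn (fun x : Fin d → ℝ => ‖x‖) (fun z => max 0 (1 - ‖z‖)) 1 ≤
      (2 - 1 / (2 * d)) / (d + 1) := by
    refine csSup_le ⟨_, 1, 1, one_pos, by simp [nball], rfl⟩ ?_
    rintro _ ⟨c, R, hR, hc, rfl⟩
    exact average_cone_le hd hR hc
  have h1 := le_holderNorm_one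
    (maxFn_sub_le (d := d) (s := 0) le_rfl zero_le_one abs_cone_sub_le)
    (x := 0) (y := 1) zero_ne_one
  rw [zero_sub, norm_neg, norm_one, div_one] at h1
  have h2 := holderNorm_maxFn_le_opNormHolder (holderNorm_cone hd)
  have h3 := one_le_maxFn_cone_zero d
  have h4 := le_abs_self (maxFn (fun x : Fin d → ℝ => ‖x‖) (fun z => max 0 (1 - ‖z‖)) 0 -
    maxFn (fun x : Fin d → ℝ => ‖x‖) (fun z => max 0 (1 - ‖z‖)) 1)
  refine lt_of_lt_of_le ?_ (h4.trans (h1.trans h2))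
  have h5 : ((d : ℝ) - 1) / (d + 1) = 1 - 2 / (d + 1) := by field_simp; ring
  have h6 : (2 - 1 / (2 * (d : ℝ))) / (d + 1) < 2 / (d + 1) := by
    gcongr
    have : 0 < 1 / (2 * (d : ℝ)) := by positivity
    linarith
  linarith

theorem cubeNormAvg_one_sub_inv_sqrt {d : ℕ} (hd : 1 ≤ d) :
    cubeNormAvg d (1 - 1 / Real.sqrt d) =
      (d : ℝ) / (d + 1) - (1 / (d + 1)) * (1 - 1 / Real.sqrt d) *
        (1 - (1 - 1 / (2 * Real.sqrt d - 1)) ^ d) := by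
  have hs : 1 ≤ Real.sqrt d := Real.one_le_sqrt.2 (by exact_mod_cast hd)
  have h : 2 * (1 - 1 / Real.sqrt d) / (1 + (1 - 1 / Real.sqrt d)) =
      1 - 1 / (2 * Real.sqrt d - 1) := by
    have h1 : 2 * Real.sqrt d - 1 ≠ 0 := by linarith
    have h0 : Real.sqrt d ≠ 0 := by linarith
    have h2 : 1 + (1 - 1 / Real.sqrt d) = (2 * Real.sqrt d - 1) / Real.sqrt d := by
      field_simp
      ring
    rw [h2]
    field_simp
    ring
  rw [cubeNormAvg, h]
  field_simp
  ring

theorem tendsto_one_sub_inv_sqrt_pow :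
    Tendsto (fun d : ℕ => (1 - 1 / (2 * Real.sqrt d - 1)) ^ d) atTop (𝓝 0) := by
  have hsq : Tendsto (fun d : ℕ => Real.sqrt d) atTop atTop :=
    Real.tendsto_sqrt_atTop.comp tendsto_natCast_atTop_atTop
  have hexp : Tendsto (fun d : ℕ => Real.exp (-(Real.sqrt d / 2))) atTop (𝓝 0) :=
    Real.tendsto_exp_neg_atTop_nhds_zero.comp (hsq.atTop_div_const two_pos)
  refine tendsto_of_tendsto_of_tendsto_of_le_of_le' tendsto_const_nhds hexp ?_ ?_
  all_goals
    filter_upwards [eventually_ge_atTop 1] with d hd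
    have hs : 1 ≤ Real.sqrt d := Real.one_le_sqrt.2 (by exact_mod_cast hd)
    have h1 : 1 / (2 * Real.sqrt d - 1) ≤ 1 := by
      rw [div_le_one (by linarith)]; linarith
    have h0 : 0 ≤ 1 - 1 / (2 * Real.sqrt d - 1) := by linarith
  · positivity
  · have h2 : 1 - 1 / (2 * Real.sqrt d - 1) ≤ Real.exp (-(1 / (2 * Real.sqrt d))) := by
      have h3 := Real.add_one_le_exp (-(1 / (2 * Real.sqrt d)))
      have h4 : 1 / (2 * Real.sqrt d) ≤ 1 / (2 * Real.sqrt d - 1) :=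
        one_div_le_one_div_of_le (by linarith) (by linarith)
      linarith
    refine (pow_le_pow_left₀ h0 h2 d).trans_eq ?_
    rw [← Real.exp_nat_mul]
    congr 1
    nth_rewrite 1 [← Real.sq_sqrt (Nat.cast_nonneg (α := ℝ) d)]
    field_simp

/-- Bounds for the operator norm of the maximal operator associated to `ℓ∞` balls on
Lipschitz functions of `(ℝ^d, ‖·‖_∞)`:
`(d−1)/(d+1) < ‖M_d‖ ≤ d/(d+1) − (1/(d+1))(1 − 1/√d)[1 − (1 − 1/(2√d−1))^d]`,
and in particular `‖M_d‖ = (d−1)/(d+1) + o(1/(d+1))` as `d → ∞`. -/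
theorem stmt9 :
    (∀ d : ℕ, 1 ≤ d →
      ((d : ℝ) - 1) / (d + 1) < opNormHolder d (fun x => ‖x‖) 1 ∧
      opNormHolder d (fun x => ‖x‖) 1 ≤
        (d : ℝ) / (d + 1) - (1 / (d + 1)) * (1 - 1 / Real.sqrt d) *
          (1 - (1 - 1 / (2 * Real.sqrt d - 1)) ^ d)) ∧
    Filter.Tendsto
      (fun d : ℕ => (opNormHolder d (fun x => ‖x‖) 1 - ((d : ℝ) - 1) / (d + 1)) * (d + 1))
      Filter.atTop (nhds 0) := by
  have hupper : ∀ d : ℕ, 1 ≤ d → opNormHolder d (fun x => ‖x‖) 1 ≤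
      (d : ℝ) / (d + 1) - (1 / (d + 1)) * (1 - 1 / Real.sqrt d) *
        (1 - (1 - 1 / (2 * Real.sqrt d - 1)) ^ d) := by
    intro d hd
    have hs : 1 ≤ Real.sqrt d := Real.one_le_sqrt.2 (by exact_mod_cast hd)
    have h1 : 1 / Real.sqrt d ≤ 1 := by
      rw [div_le_one (by linarith)]; exact hs
    have h0 : 0 ≤ 1 / Real.sqrt d := by positivity
    rw [← cubeNormAvg_one_sub_inv_sqrt hd]
    exact opNormHolder_one_le (by linarith) (by linarith)
  refine ⟨fun d hd => ⟨lt_opNormHolder_one hd, hupper d hd⟩, ?_⟩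
  have hsq : Tendsto (fun d : ℕ => 1 / Real.sqrt d) atTop (𝓝 0) := by
    simp only [one_div]
    exact tendsto_inv_atTop_zero.comp (Real.tendsto_sqrt_atTop.comp tendsto_natCast_atTop_atTop)
  have hlim : Tendsto (fun d : ℕ => 1 - (1 - 1 / Real.sqrt d) *
      (1 - (1 - 1 / (2 * Real.sqrt d - 1)) ^ d)) atTop (𝓝 0) := by
    have h := (hsq.const_sub 1).mul (tendsto_one_sub_inv_sqrt_pow.const_sub 1) |>.const_sub 1
    simpa using h
  refine tendsto_of_tendsto_of_tendsto_of_le_of_le' tendsto_const_nhds hlim ?_ ?_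
  · filter_upwards [eventually_ge_atTop 1] with d hd
    exact mul_nonneg (sub_nonneg.2 (lt_opNormHolder_one hd).le) (by positivity)
  · filter_upwards [eventually_ge_atTop 1] with d hd
    have hp : (0 : ℝ) < d + 1 := by positivity
    refine (mul_le_mul_of_nonneg_right (sub_le_sub_right (hupper d hd) _) hp.le).trans_eq ?_
    generalize (1 - 1 / (2 * Real.sqrt d - 1)) ^ d = p
    generalize 1 / Real.sqrt d = q
    field_simp
    ring
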